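/- arXiv:1201.0893 — 5 statements merged into one kernel-verified Lean document; each statement's English description precedes it below -/
import Mathlib

section
/- Let p > 1 and c < 0 be fixed real numbers. If (1-c)/p ≤ (1 + (1-c)/p)^(1-p), then for every real x with 0 ≤ x ≤ 1 one has ((1-c)/p)·x ≤ (1 + ((1-c)/p)·x)^(1-p) − (1−x)^(1−c). -/
/-- If `1 + (p - 1) * (1 + a * x) ^ (-p) ≤ p * (1 - x) ^ q` holds at `x = y`, then it holds on the
whole segment from `0` to `y`. -/
lemma one_add_mul_rpow_neg_le_mul_one_sub_rpow_of_segment {p a q y t : ℝ} (hp : 1 < p) (ha : 0 < a)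
    (hq : 0 ≤ q) (hy0 : 0 ≤ y) (hy1 : y ≤ 1) (ht0 : 0 ≤ t) (ht1 : t ≤ 1)
    (h : 1 + (p - 1) * (1 + a * y) ^ (-p) ≤ p * (1 - y) ^ q) :
    1 + (p - 1) * (1 + a * (t * y)) ^ (-p) ≤ p * (1 - t * y) ^ q := by
  have hp0 : 0 < p := by linarith
  have hay : 0 < 1 + a * y := by positivity
  have h1y : 0 ≤ 1 - y := by linarith
  have hA : ((1 - y) ^ q) ^ t ≤ (1 - t * y) ^ q := by
    have hb := rpow_one_add_le_one_add_mul_self (s := -y) (by linarith) ht0 ht1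
    calc ((1 - y) ^ q) ^ t = ((1 - y) ^ t) ^ q := by
          rw [← Real.rpow_mul h1y, ← Real.rpow_mul h1y, mul_comm]
      _ ≤ (1 - t * y) ^ q := by
          refine Real.rpow_le_rpow (by positivity) ?_ hq
          convert hb using 1 <;> ring_nf
  have hB : (1 + a * (t * y)) ^ (-p) ≤ ((1 + a * y) ^ (-p)) ^ t := by
    have hb := rpow_one_add_le_one_add_mul_self (s := a * y)
      (by linarith) ht0 ht1
    calc (1 + a * (t * y)) ^ (-p) ≤ ((1 + a * y) ^ t) ^ (-p) := by
          refine Real.rpow_le_rpow_of_nonpos (by positivity) ?_ (by linarith)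
          convert hb using 1; ring
      _ = ((1 + a * y) ^ (-p)) ^ t := by
          rw [← Real.rpow_mul hay.le, ← Real.rpow_mul hay.le, mul_comm t]
  set A := (1 - y) ^ q
  set B := (1 + a * y) ^ (-p)
  have hB0 : 0 ≤ B := by positivity
  have hconc := (Real.concaveOn_rpow ht0 ht1).2 (Set.mem_Ici.2 zero_le_one) (Set.mem_Ici.2 hB0)
    (by positivity : 0 ≤ 1 / p)
    (div_nonneg (by linarith) hp0.le : 0 ≤ (p - 1) / p) (by field_simp; ring)
  simp only [smul_eq_mul, Real.one_rpow] at hconc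
  have hle : 1 / p * 1 + (p - 1) / p * B ≤ A := by
    rw [show 1 / p * 1 + (p - 1) / p * B = (1 + (p - 1) * B) / p by ring, div_le_iff₀ hp0]
    linarith
  have hmono := Real.rpow_le_rpow
    (add_nonneg (by positivity) (mul_nonneg (div_nonneg (by linarith) hp0.le) hB0)) hle ht0
  have hpow : 1 + (p - 1) * B ^ t ≤ p * A ^ t := by
    have := hconc.trans hmono
    rw [show 1 / p * 1 + (p - 1) / p * B ^ t = (1 + (p - 1) * B ^ t) / p by ring,
      div_le_iff₀ hp0] at this
    linarith
  calc 1 + (p - 1) * (1 + a * (t * y)) ^ (-p) ≤ 1 + (p - 1) * B ^ t := by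
        gcongr
    _ ≤ p * A ^ t := hpow
    _ ≤ p * (1 - t * y) ^ q := by gcongr

lemma hasDerivAt_one_add_mul_rpow_sub_one_sub_rpow_sub {p a x : ℝ} (hx : 1 + a * x ≠ 0)
    (hap : 1 ≤ a * p) :
    HasDerivAt (fun y : ℝ => (1 + a * y) ^ (1 - p) - (1 - y) ^ (a * p) - a * y)
      (a * (p * (1 - x) ^ (a * p - 1) - (1 + (p - 1) * (1 + a * x) ^ (-p)))) x := by
  have hl : HasDerivAt (fun y : ℝ => a * y) a x := by
    simpa using (hasDerivAt_id x).const_mul a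
  have h1 := (hl.const_add 1).rpow_const (p := 1 - p) (Or.inl hx)
  have h2 := ((hasDerivAt_id x).const_sub 1).rpow_const (p := a * p) (Or.inr hap)
  refine ((h1.sub h2).sub hl).congr_deriv ?_
  rw [show 1 - p - 1 = -p by ring]
  simp only [id]
  ring

/-- Lemma 2.1 (case `p > 1`, `c < 0`): if the inequality
`((1-c)/p) * x ≤ (1 + ((1-c)/p) * x) ^ (1-p) - (1-x) ^ (1-c)` holds at `x = 1`
(which is exactly the hypothesis `(1-c)/p ≤ (1 + (1-c)/p) ^ (1-p)`), then it
holds for all `0 ≤ x ≤ 1`.  All powers are real powers (`Real.rpow`). -/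
theorem copson_lemma_p_gt_one (p c : ℝ) (hp : 1 < p) (hc : c < 0)
    (h1 : (1 - c) / p ≤ (1 + (1 - c) / p) ^ (1 - p)) :
    ∀ x : ℝ, 0 ≤ x → x ≤ 1 →
      ((1 - c) / p) * x ≤ (1 + ((1 - c) / p) * x) ^ (1 - p) - (1 - x) ^ (1 - c) := by
  intro x hx0 hx1
  have hp0 : 0 < p := by linarith
  have hc' : 1 - c = (1 - c) / p * p := by field_simp
  have ha : 0 < (1 - c) / p := div_pos (by linarith) hp0
  have hap : 1 < (1 - c) / p * p := by linarith
  rw [show (1 - x) ^ (1 - c) = (1 - x) ^ ((1 - c) / p * p) by rw [← hc']]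
  generalize (1 - c) / p = a at *
  set f : ℝ → ℝ := fun y => (1 + a * y) ^ (1 - p) - (1 - y) ^ (a * p) - a * y with hf
  have hf0 : f 0 = 0 := by simp [hf]
  have hf1 : 0 ≤ f 1 := by
    simp only [hf, mul_one, sub_self, Real.zero_rpow (by linarith : a * p ≠ 0)]
    linarith
  suffices 0 ≤ f x by simp only [hf] at this; linarith
  by_contra! hneg
  have hx0' : 0 < x := hx0.lt_of_ne (by rintro rfl; linarith)
  have hx1' : x < 1 := hx1.lt_of_ne (by rintro rfl; linarith)
  have hd (y : ℝ) (hy : 0 ≤ y) := hasDerivAt_one_add_mul_rpow_sub_one_sub_rpow_sub (x := y)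
    (by positivity : 1 + a * y ≠ 0) hap.le
  obtain ⟨u, hu, hu'⟩ := exists_hasDerivAt_eq_slope f _ hx0'
    (fun y hy => (hd y hy.1).continuousAt.continuousWithinAt) (fun y hy => hd y hy.1.le)
  obtain ⟨v, hv, hv'⟩ := exists_hasDerivAt_eq_slope f _ hx1'
    (fun y hy => (hd y (hx0.trans hy.1)).continuousAt.continuousWithinAt)
    (fun y hy => hd y (hx0.trans hy.1.le))
  have hu_neg : (f x - f 0) / (x - 0) < 0 := div_neg_of_neg_of_pos (by linarith) (by linarith)
  have hv_pos : 0 < (f 1 - f x) / (1 - x) := div_pos (by linarith) (by linarith)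
  rw [← hu'] at hu_neg
  rw [← hv'] at hv_pos
  have hv_pos' := pos_of_mul_pos_right hv_pos ha.le
  have hu_neg' := neg_of_mul_neg_right hu_neg ha.le
  have hv0 : 0 < v := hx0'.trans hv.1
  have key := one_add_mul_rpow_neg_le_mul_one_sub_rpow_of_segment (t := u / v) (q := a * p - 1) hp ha
    (by linarith) hv0.le hv.2.le (div_nonneg hu.1.le hv0.le)
    ((div_le_one hv0).2 (hu.2.trans hv.1).le) (by linarith)
  rw [div_mul_cancel₀ _ hv0.ne'] at key
  linarith
end

section
/- Let p and c be fixed real numbers with 0 < p < 1 and 0 < c < 1. If (1-c)/p ≥ (1 + (1-c)/p)^(1-p), then for every real x with 0 ≤ x ≤ 1 one has ((1-c)/p)·x ≥ (1 + ((1-c)/p)·x)^(1-p) − (1−x)^(1−c). -/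
theorem convexOn_rpow_neg {r : ℝ} (hr : 0 ≤ r) :
    ConvexOn ℝ (Set.Ioi 0) fun x : ℝ => x ^ (-r) := by
  have hlog : ConvexOn ℝ (Set.Ioi 0) fun x : ℝ => -r * Real.log x := by
    simpa [Pi.smul_def, neg_mul] using (strictConcaveOn_log_Ioi.concaveOn.neg.smul hr)
  refine ((convexOn_exp.subset (Set.subset_univ _) ?_).comp hlog
    (Real.exp_monotone.monotoneOn _)).congr fun x hx => ?_
  · refine Set.OrdConnected.convex (IsPreconnected.ordConnected ?_)
    exact isPreconnected_Ioi.image _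
      (continuousOn_const.mul (Real.continuousOn_log.mono fun x hx => ne_of_gt hx))
  · simp [Real.rpow_def_of_pos hx, mul_comm]

/-- A function on `[0, 1]` vanishing at `0`, with a concave derivative vanishing at `0`, is
nonnegative as soon as it is nonnegative at `1`. -/
theorem nonneg_of_concaveOn_deriv {f f' : ℝ → ℝ} (hf : ContinuousOn f (Set.Icc 0 1))
    (hff' : ∀ x ∈ Set.Ioo (0 : ℝ) 1, HasDerivAt f (f' x) x)
    (hf' : ConcaveOn ℝ (Set.Ico 0 1) f') (h0' : f' 0 = 0) (h0 : f 0 = 0) (h1 : 0 ≤ f 1)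
    {x : ℝ} (hx : x ∈ Set.Icc (0 : ℝ) 1) : 0 ≤ f x := by
  by_contra! hneg
  have hx0 : 0 < x := lt_of_le_of_ne hx.1 (by rintro rfl; linarith)
  have hx1 : x < 1 := lt_of_le_of_ne hx.2 (by rintro rfl; linarith)
  obtain ⟨u, hu, hfu⟩ := exists_hasDerivAt_eq_slope f f' hx0
    (hf.mono (Set.Icc_subset_Icc_right hx.2)) fun y hy => hff' y ⟨hy.1, hy.2.trans hx1⟩
  obtain ⟨v, hv, hfv⟩ := exists_hasDerivAt_eq_slope f f' hx1
    (hf.mono (Set.Icc_subset_Icc_left hx.1)) fun y hy => hff' y ⟨hx0.trans hy.1, hy.2⟩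
  have hu_neg : f' u < 0 := by
    rw [hfu]; exact div_neg_of_neg_of_pos (by linarith) (by linarith)
  have hv_pos : 0 < f' v := by
    rw [hfv]; exact div_pos (by linarith) (by linarith)
  have hv0 : 0 < v := hx0.trans hv.1
  have huv : u / v ≤ 1 := (div_le_one hv0).2 (hu.2.trans hv.1).le
  have hslope := hf'.2 (x := 0) (y := v) (by simp) ⟨hv0.le, hv.2⟩ (sub_nonneg.2 huv)
    (div_nonneg hu.1.le hv0.le) (by ring)
  simp only [smul_eq_mul, mul_zero, zero_add, h0', div_mul_cancel₀ _ hv0.ne'] at hslope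
  exact absurd (mul_pos (div_pos hu.1 hv0) hv_pos) (by linarith)


/-- Lemma 2.1 (case `0 < p < 1`, `0 < c < 1`): if the reversed inequality
`((1-c)/p) * x ≥ (1 + ((1-c)/p) * x) ^ (1-p) - (1-x) ^ (1-c)` holds at `x = 1`
(which is exactly the hypothesis `(1-c)/p ≥ (1 + (1-c)/p) ^ (1-p)`), then it
holds for all `0 ≤ x ≤ 1`.  All powers are real powers (`Real.rpow`). -/
theorem copson_lemma_p_lt_one (p c : ℝ) (hp0 : 0 < p) (hp1 : p < 1)
    (hc0 : 0 < c) (hc1 : c < 1)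
    (h1 : (1 + (1 - c) / p) ^ (1 - p) ≤ (1 - c) / p) :
    ∀ x : ℝ, 0 ≤ x → x ≤ 1 →
      (1 + ((1 - c) / p) * x) ^ (1 - p) - (1 - x) ^ (1 - c) ≤ ((1 - c) / p) * x := by
  intro x hx0 hx1
  have hap : (1 - c) / p * p = 1 - c := div_mul_cancel₀ _ hp0.ne'
  have ha : 0 < (1 - c) / p := div_pos (by linarith) hp0
  set a := (1 - c) / p
  have hcont : ContinuousOn (fun y : ℝ => a * y + (1 - y) ^ (1 - c) - (1 + a * y) ^ (1 - p))
      (Set.Icc 0 1) := by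
    have hleft : Continuous fun y : ℝ => (1 - y) ^ (1 - c) :=
      (by fun_prop : Continuous fun y : ℝ => 1 - y).rpow_const fun _ => Or.inr (by linarith)
    have hright : Continuous fun y : ℝ => (1 + a * y) ^ (1 - p) :=
      (by fun_prop : Continuous fun y : ℝ => 1 + a * y).rpow_const fun _ => Or.inr (by linarith)
    fun_prop
  have hderiv : ∀ y ∈ Set.Ioo (0 : ℝ) 1,
      HasDerivAt (fun y : ℝ => a * y + (1 - y) ^ (1 - c) - (1 + a * y) ^ (1 - p))
        (a - ((1 - c) * (1 - y) ^ (-c) + a * (1 - p) * (1 + a * y) ^ (-p))) y := by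
    intro y hy
    have hlin : HasDerivAt (fun y : ℝ => a * y) a y := by
      simpa using (hasDerivAt_id y).const_mul a
    have hleft := ((hasDerivAt_id y).const_sub 1).rpow_const (p := 1 - c)
      (Or.inl (sub_pos.2 hy.2).ne')
    have hright := (hlin.const_add 1).rpow_const (p := 1 - p)
      (Or.inl (by have := mul_pos ha hy.1; positivity))
    refine ((hlin.add hleft).sub hright).congr_deriv ?_
    rw [show 1 - c - 1 = -c by ring, show 1 - p - 1 = -p by ring]
    simp only [id]
    ring
  have hconc : ConcaveOn ℝ (Set.Ico 0 1) fun y : ℝ =>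
      a - ((1 - c) * (1 - y) ^ (-c) + a * (1 - p) * (1 + a * y) ^ (-p)) := by
    have hleft : ConvexOn ℝ (Set.Ico 0 1) fun y : ℝ => (1 - y) ^ (-c) := by
      refine ⟨convex_Ico 0 1, fun y hy z hz s t hs ht hst => ?_⟩
      convert (convexOn_rpow_neg hc0.le).2 (x := 1 - y) (y := 1 - z)
        (sub_pos.2 hy.2) (sub_pos.2 hz.2) hs ht hst using 2
      simp only [smul_eq_mul]
      linear_combination -hst
    have hright : ConvexOn ℝ (Set.Ico 0 1) fun y : ℝ => (1 + a * y) ^ (-p) := by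
      refine ⟨convex_Ico 0 1, fun y hy z hz s t hs ht hst => ?_⟩
      convert (convexOn_rpow_neg hp0.le).2 (x := 1 + a * y) (y := 1 + a * z)
        (by have := mul_nonneg ha.le hy.1; simp only [Set.mem_Ioi]; linarith)
        (by have := mul_nonneg ha.le hz.1; simp only [Set.mem_Ioi]; linarith) hs ht hst using 2
      simp only [smul_eq_mul]
      linear_combination -hst
    exact (concaveOn_const a (convex_Ico 0 1)).sub
      ((hleft.smul (sub_nonneg.2 hc1.le)).add
        (hright.smul (mul_nonneg ha.le (sub_nonneg.2 hp1.le))))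
  have hzero : a - ((1 - c) * (1 - 0 : ℝ) ^ (-c) + a * (1 - p) * (1 + a * 0) ^ (-p)) = 0 := by
    simp only [sub_zero, mul_zero, add_zero, Real.one_rpow]
    linear_combination hap
  have := nonneg_of_concaveOn_deriv hcont hderiv hconc hzero (by simp)
    (by simpa [Real.zero_rpow (sub_pos.2 hc1).ne'] using h1) ⟨hx0, hx1⟩
  linarith
end

section
/- Let p > 1 and let α be a real number with α ≥ 1 − 1/(2p). Then for every real x with 0 < x ≤ 1 one has (p/(p−1)) · ((1 − x/p)^(1−p) − 1) ≥ x · ((1 − (1−x)^α)/(αx))^p. -/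
/-- A rational upper bound for `1 - (1 - x) ^ α`, coming from the weighted AM-GM inequality when
`α ≤ 1` and from Bernoulli's inequality when `1 ≤ α`. -/
theorem one_sub_one_sub_rpow_mul_le {α c x : ℝ} (hα : 0 < α) (hc : 0 ≤ c) (hcα : 1 - c ≤ α)
    (hx : 0 ≤ x) (hx1 : x ≤ 1) :
    (1 - (1 - x) ^ α) * (1 - c * x) ≤ α * x := by
  have ht : 0 ≤ 1 - x := by linarith
  have hA : 0 ≤ 1 - (1 - x) ^ α := by
    linarith [Real.rpow_le_one ht (by linarith) hα.le]
  rcases le_total α 1 with h1 | h1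
  · have amgm := Real.geom_mean_le_arith_mean2_weighted hα.le (sub_nonneg.2 h1) zero_le_one ht
      (by ring)
    rw [Real.one_rpow, one_mul, mul_one] at amgm
    have hmul : (1 - x) ^ α * (1 - x) ^ (1 - α) = 1 - x := by
      rw [← Real.rpow_add_of_nonneg ht hα.le (sub_nonneg.2 h1)]
      simp
    have h2 := mul_le_mul_of_nonneg_left amgm (Real.rpow_nonneg ht α)
    have h3 : (1 - (1 - x) ^ α) * (1 - c * x) ≤ (1 - (1 - x) ^ α) * (1 - (1 - α) * x) := by
      gcongr
      linarith
    rw [hmul] at h2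
    linarith
  · have bern := one_add_mul_self_le_rpow_one_add (s := -x) (by linarith) h1
    rw [← sub_eq_add_neg] at bern
    nlinarith [mul_nonneg hA (mul_nonneg hc hx)]

theorem two_mul_mul_le_rpow_neg_sub_rpow_neg {q u : ℝ} (hq : 0 ≤ q) (hu : 0 ≤ u) (hu1 : u < 1) :
    2 * q * u ≤ (1 - u) ^ (-q) - (1 + u) ^ (-q) := by
  have h1 : 0 < 1 - u := by linarith
  have h2 : 0 < 1 + u := by linarith
  set a := Real.log (1 - u) with ha
  set b := Real.log (1 + u) with hb
  have hab : a + b ≤ 0 := by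
    rw [ha, hb, ← Real.log_mul h1.ne' h2.ne']
    exact Real.log_nonpos (by positivity) (by nlinarith)
  have hdiff : 2 * u ≤ b - a := by
    have h := Real.sum_range_le_log_div hu hu1 1
    rw [Real.log_div h2.ne' h1.ne'] at h
    simp only [Finset.sum_range_one] at h
    norm_num at h
    linarith
  set s := q * (b - a) / 2 with hs
  have hqs : q * u ≤ s := by nlinarith
  have hs0 : 0 ≤ s := (mul_nonneg hq hu).trans hqs
  have hsinh := Real.self_le_sinh_iff.2 hs0
  have hexp : 1 ≤ Real.exp (-(q * (a + b) / 2)) := Real.one_le_exp (by nlinarith)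
  calc 2 * q * u ≤ 2 * Real.sinh s := by linarith
    _ ≤ Real.exp (-(q * (a + b) / 2)) * (2 * Real.sinh s) :=
      le_mul_of_one_le_left (by linarith) hexp
    _ = (1 - u) ^ (-q) - (1 + u) ^ (-q) := by
      rw [Real.rpow_def_of_pos h1, Real.rpow_def_of_pos h2, Real.sinh_eq,
        mul_div_cancel₀ _ two_ne_zero,
        mul_sub, ← Real.exp_add, ← Real.exp_add]
      congr 2 <;> rw [hs] <;> ring

/-- The midpoint (Hermite–Hadamard) bound for the integral of `s ↦ (1 - s / p) ^ (-p)`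
over `[0, x]`. -/
theorem mul_rpow_neg_le_rpow_one_sub_sub_one {p x : ℝ} (hp : 1 < p) (hx : 0 ≤ x) (hxp : x < p) :
    x * (1 - x / (2 * p)) ^ (-p) ≤ p / (p - 1) * ((1 - x / p) ^ (1 - p) - 1) := by
  have hp0 : 0 < p := by linarith
  have hq : 0 < p - 1 := by linarith
  have hd : 0 < 2 * p - x := by linarith
  set m := 1 - x / (2 * p) with hm
  have hm_eq : m = (2 * p - x) / (2 * p) := by rw [hm]; field_simp
  have hm0 : 0 < m := by rw [hm_eq]; positivity
  set u := x / (2 * p - x) with hu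
  have hu0 : 0 ≤ u := div_nonneg hx hd.le
  have hu1 : u < 1 := by rw [hu, div_lt_one hd]; linarith
  have hmul_sub : m * (1 - u) = 1 - x / p := by
    rw [hm_eq, hu]; field_simp; ring
  have hmul_add : m * (1 + u) = 1 := by
    rw [hm_eq, hu]; field_simp; ring
  have hmu : m * u = x / (2 * p) := by
    rw [hm_eq, hu]; field_simp
  have key := mul_le_mul_of_nonneg_left
    (two_mul_mul_le_rpow_neg_sub_rpow_neg hq.le hu0 hu1) (Real.rpow_nonneg hm0.le (-(p - 1)))
  rw [mul_sub (m ^ _), ← Real.mul_rpow hm0.le (by linarith),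
    ← Real.mul_rpow hm0.le (by linarith),
    hmul_sub, hmul_add, Real.one_rpow, neg_sub] at key
  have hpow : m ^ (1 - p) = m * m ^ (-p) := by
    rw [sub_eq_add_neg, Real.rpow_add hm0, Real.rpow_one]
  calc x * m ^ (-p) = p / (p - 1) * (m ^ (1 - p) * (2 * (p - 1) * u)) := by
        rw [hpow, show m * m ^ (-p) * (2 * (p - 1) * u) = m ^ (-p) * (2 * (p - 1)) * (m * u) by ring,
          hmu]
        field_simp
    _ ≤ _ := by gcongr

/-- Inequality (3.2): for `p > 1`, `α ≥ 1 - 1/(2p)` and `0 < x ≤ 1`,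
`(p/(p-1)) * ((1 - x/p) ^ (1-p) - 1) ≥ x * ((1 - (1-x)^α)/(α*x)) ^ p`.
All powers are real powers (`Real.rpow`). -/
theorem ineq_three_two (p α : ℝ) (hp : 1 < p) (hα : 1 - 1 / (2 * p) ≤ α) :
    ∀ x : ℝ, 0 < x → x ≤ 1 →
      x * ((1 - (1 - x) ^ α) / (α * x)) ^ p
        ≤ (p / (p - 1)) * ((1 - x / p) ^ (1 - p) - 1) := by
  intro x hx hx1
  have hp0 : 0 < p := by linarith
  have hc : 1 / (2 * p) < 1 := by rw [div_lt_one (by positivity)]; linarith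
  have hα0 : 0 < α := by linarith
  have hm : 0 < 1 - x / (2 * p) := by
    rw [sub_pos, div_lt_one (by positivity)]; linarith
  have hbase : 0 ≤ (1 - (1 - x) ^ α) / (α * x) :=
    div_nonneg (sub_nonneg.2 (Real.rpow_le_one (by linarith) (by linarith) hα0.le)) (by positivity)
  have hle : (1 - (1 - x) ^ α) / (α * x) ≤ (1 - x / (2 * p))⁻¹ := by
    rw [div_le_iff₀ (by positivity), inv_mul_eq_div, le_div_iff₀ hm]
    have h := one_sub_one_sub_rpow_mul_le hα0 (by positivity) hα hx.le hx1
    rwa [one_div_mul_eq_div] at h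
  calc x * ((1 - (1 - x) ^ α) / (α * x)) ^ p ≤ x * (1 - x / (2 * p)) ^ (-p) := by
        rw [Real.rpow_neg hm.le, ← Real.inv_rpow hm.le]
        gcongr
    _ ≤ _ := mul_rpow_neg_le_rpow_one_sub_sub_one hp hx.le (by linarith)
end

section
/- Let p > 1 and let α be a real number with α ≥ 1 − 1/(2p). Then for every real x with 0 ≤ x ≤ 1 one has α·x ≥ (1 − x/(2p)) · (1 − (1−x)^α). -/
/-- For `p > 1`, `α ≥ 1 - 1/(2p)` and `0 ≤ x ≤ 1`,
`α * x ≥ (1 - x/(2p)) * (1 - (1-x)^α)`, i.e. `f_{α,p}(x) ≥ 0` on `[0,1]`.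
Here `(1-x)^α` is the real power (`Real.rpow`). -/
theorem f_alpha_p_nonneg (p α : ℝ) (hp : 1 < p) (hα : 1 - 1 / (2 * p) ≤ α) :
    ∀ x : ℝ, 0 ≤ x → x ≤ 1 →
      (1 - x / (2 * p)) * (1 - (1 - x) ^ α) ≤ α * x := by
  intro x hx0 hx1
  obtain ⟨c, hc⟩ : ∃ c, c = 1 / (2 * p) := ⟨_, rfl⟩
  have hc0 : 0 < c := by rw [hc]; positivity
  have hc1 : c < 1 := by rw [hc, div_lt_one (by linarith)]; linarith
  have hxc : x / (2 * p) = c * x := by rw [hc]; ring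
  rw [← hc] at hα
  rw [hxc]
  have hα0 : 0 < α := by linarith
  have ht0 : 0 ≤ 1 - x := by linarith
  have hpow : (1 - x) ^ α ≤ 1 := Real.rpow_le_one ht0 (by linarith) hα0.le
  rcases le_total 1 α with h1 | h1
  · have bernoulli := one_add_mul_self_le_rpow_one_add (s := -x) (by linarith) h1
    rw [← sub_eq_add_neg] at bernoulli
    nlinarith [mul_nonneg (mul_nonneg hc0.le hx0) (sub_nonneg.2 hpow)]
  · have amgm := Real.geom_mean_le_arith_mean2_weighted hα0.le (sub_nonneg.2 h1)
      zero_le_one ht0 (by ring)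
    rw [Real.one_rpow, one_mul] at amgm
    have hsplit : (1 - x) ^ α * (1 - x) ^ (1 - α) = 1 - x := by
      rw [← Real.rpow_add_of_nonneg ht0 hα0.le (sub_nonneg.2 h1), add_sub_cancel, Real.rpow_one]
    have hmul := mul_le_mul_of_nonneg_left amgm (Real.rpow_nonneg ht0 α)
    rw [hsplit] at hmul
    have hcα : 0 ≤ (c - (1 - α)) * x * (1 - (1 - x) ^ α) :=
      mul_nonneg (mul_nonneg (by linarith) hx0) (sub_nonneg.2 hpow)
    linarith
end

section
/- Let p > 1 and let α be a real number with α ≥ 1. Then for every positive real sequence (λ_n)_{n≥1} with ∑_{n=1}^∞ λ_n < ∞ and every nonnegative sequence (y_n)_{n≥1}, writing Λ*_n = ∑_{k=n}^∞ λ_k, one has ∑_{n=1}^∞ ( (((Λ*_n)^α − (Λ*_{n+1})^α)/(λ_n^{1−1/p} (Λ*_n)^α)) · ∑_{k=n}^∞ λ_k^{1−1/p} y_k )^p ≤ (αp/(p−1))^p ∑_{n=1}^∞ y_n^p. -/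
/-- One step of the weighted Hardy inequality for tail averages. -/
lemma hardy_step {p q l m x a b : ℝ} (hpq : p.HolderConjugate q) (hl : 0 ≤ l) (hm : 0 ≤ m)
    (hx : 0 ≤ x) (ha : 0 ≤ a) (hb : 0 ≤ b) (h : (l + m) * a = l * x + m * b) :
    l * a ^ p + q * ((l + m) * a ^ p) ≤ q ^ p * (l * x ^ p) + q * (m * b ^ p) := by
  have hp0 := hpq.pos
  have hq0 := hpq.symm.pos
  have hmul : p * q = p + q := hpq.mul_eq_add
  have ha' : 0 ≤ a ^ (p - 1) := Real.rpow_nonneg ha _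
  have hpow : (a ^ (p - 1)) ^ q = a ^ p := by
    rw [← Real.rpow_mul ha]
    congr 1
    linarith
  have hsplit : a * a ^ (p - 1) = a ^ p := by
    rw [mul_comm, ← Real.rpow_add_one' ha (by linarith), sub_add_cancel]
  have young (c : ℝ) (hc : 0 ≤ c) : p * q * (c * a ^ (p - 1)) ≤ q * c ^ p + p * a ^ p := by
    have := Real.young_inequality_of_nonneg hc ha' hpq
    rw [hpow] at this
    calc p * q * (c * a ^ (p - 1)) ≤ p * q * (c ^ p / p + a ^ p / q) := by gcongr
      _ = q * c ^ p + p * a ^ p := by field_simp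
  have h₁ := young (q * x) (by positivity)
  rw [Real.mul_rpow hq0.le hx] at h₁
  have h₂ := young b hb
  have h₃ : (l + m) * a ^ p = l * (x * a ^ (p - 1)) + m * (b * a ^ (p - 1)) := by
    rw [← hsplit]
    linear_combination a ^ (p - 1) * h
  have h₅ := mul_le_mul_of_nonneg_left h₂ hm
  have h₆ : p * q * q * ((l + m) * a ^ p) ≤ l * (q * (q ^ p * x ^ p) + p * a ^ p)
      + q * (m * (q * b ^ p + p * a ^ p)) := by
    rw [h₃]
    nlinarith [mul_le_mul_of_nonneg_left h₅ hq0.le]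
  refine le_of_mul_le_mul_left ?_ hq0
  linear_combination h₆ - (l * (q + 1) + m * q) * a ^ p * hmul

/-- Weighted Hardy inequality for tail averages, for finite sums. -/
lemma hardy_sum_range {p q : ℝ} (hpq : p.HolderConjugate q) {l L S x : ℕ → ℝ}
    (hl : ∀ n, 0 ≤ l n) (hL : ∀ n, 0 < L n) (hx : ∀ n, 0 ≤ x n) (hS : ∀ n, 0 ≤ S n)
    (hLs : ∀ n, L n = l n + L (n + 1)) (K : ℕ)
    (hSs : ∀ n < K, S n = l n * x n + S (n + 1)) (hSK : S K = 0) :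
    ∑ n ∈ Finset.range K, l n * (S n / L n) ^ p ≤
      q ^ p * ∑ n ∈ Finset.range K, l n * x n ^ p := by
  have hq0 := hpq.symm.pos
  have key : ∀ M ≤ K, ∑ n ∈ Finset.range M, l n * (S n / L n) ^ p + q * (L 0 * (S 0 / L 0) ^ p) ≤
      q ^ p * ∑ n ∈ Finset.range M, l n * x n ^ p + q * (L M * (S M / L M) ^ p) := by
    intro M
    induction M with
    | zero => simp
    | succ M ih =>
      intro hM
      have hstep := hardy_step hpq (hl M) (hL (M + 1)).le (hx M) (div_nonneg (hS M) (hL M).le)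
        (div_nonneg (hS (M + 1)) (hL (M + 1)).le) (by
          rw [← hLs, mul_div_cancel₀ _ (hL M).ne', mul_div_cancel₀ _ (hL (M + 1)).ne',
            hSs M (by lia)])
      rw [← hLs] at hstep
      rw [Finset.sum_range_succ, Finset.sum_range_succ]
      linarith [ih (by lia)]
  have := key K le_rfl
  rw [hSK, zero_div, Real.zero_rpow hpq.ne_zero, mul_zero, mul_zero, add_zero] at this
  have h0 : 0 ≤ q * (L 0 * (S 0 / L 0) ^ p) :=
    mul_nonneg hq0.le (mul_nonneg (hL 0).le (Real.rpow_nonneg (div_nonneg (hS 0) (hL 0).le) _))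
  linarith

/-- Bernoulli's inequality, in homogeneous form. -/
lemma rpow_sub_rpow_div_le {α u v : ℝ} (hα : 1 ≤ α) (hu : 0 < u) (hv : 0 ≤ v) :
    (u ^ α - v ^ α) / u ^ α ≤ α * ((u - v) / u) := by
  have hvu : 0 ≤ v / u := by positivity
  have h := one_add_mul_self_le_rpow_one_add (s := v / u - 1) (by linarith) hα
  rw [add_sub_cancel, Real.div_rpow hv hu.le] at h
  rw [sub_div, sub_div, div_self (Real.rpow_pos_of_pos hu α).ne', div_self hu.ne']
  linarith

/-- The inequality for finite sums, with weights `l` and tails `L`. -/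
lemma hardy_rpow_sum_range {p α : ℝ} (hp : 1 < p) (hα : 1 ≤ α) {l L y : ℕ → ℝ}
    (hl : ∀ n, 0 < l n) (hL : ∀ n, 0 < L n) (hy : ∀ n, 0 ≤ y n)
    (hLs : ∀ n, L n = l n + L (n + 1)) (K : ℕ) :
    ∑ n ∈ Finset.range K, ((L n ^ α - L (n + 1) ^ α) / (l n ^ (1 - 1 / p) * L n ^ α) *
        ∑ k ∈ Finset.Ico n K, l k ^ (1 - 1 / p) * y k) ^ p ≤
      (α * p / (p - 1)) ^ p * ∑ n ∈ Finset.range K, y n ^ p := by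
  have hp0 : 0 < p := by linarith
  have hα0 : 0 < α := by linarith
  have hpq : p.HolderConjugate (p / (p - 1)) := Real.HolderConjugate.conjExponent hp
  have hterm (k : ℕ) : 0 ≤ l k ^ (1 - 1 / p) * y k :=
    mul_nonneg (Real.rpow_nonneg (hl k).le _) (hy k)
  set S : ℕ → ℝ := fun n ↦ ∑ k ∈ Finset.Ico n K, l k ^ (1 - 1 / p) * y k with hSdef
  have hS (n : ℕ) : 0 ≤ S n := Finset.sum_nonneg fun k _ ↦ hterm k
  have hx (n : ℕ) : l n * (y n / l n ^ (1 / p)) ^ p = y n ^ p := by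
    rw [Real.div_rpow (hy n) (Real.rpow_nonneg (hl n).le _), ← Real.rpow_mul (hl n).le,
      one_div_mul_cancel hp0.ne', Real.rpow_one, mul_div_cancel₀ _ (hl n).ne']
  have hardy := hardy_sum_range hpq (S := S) (x := fun n ↦ y n / l n ^ (1 / p))
    (fun n ↦ (hl n).le) hL (fun n ↦ div_nonneg (hy n) (Real.rpow_nonneg (hl n).le _)) hS hLs K
    (fun n hn ↦ by
      simp only [hSdef]
      rw [Finset.sum_eq_sum_Ico_succ_bot hn, Real.rpow_sub (hl n), Real.rpow_one]
      ring)
    (by simp [hSdef])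
  simp only [hx] at hardy
  calc _ ≤ ∑ n ∈ Finset.range K, α ^ p * (l n * (S n / L n) ^ p) := by
        refine Finset.sum_le_sum fun n _ ↦ ?_
        have hln := hl n
        have hLn := hL n
        have hw : 0 < l n ^ (1 - 1 / p) := Real.rpow_pos_of_pos hln _
        have hlp : l n = (l n ^ (1 / p)) ^ p := by
          rw [← Real.rpow_mul hln.le, one_div_mul_cancel hp0.ne', Real.rpow_one]
        have hc := rpow_sub_rpow_div_le hα hLn (hL (n + 1)).le
        rw [show L n - L (n + 1) = l n by linarith [hLs n]] at hc
        have hcnn : 0 ≤ L n ^ α - L (n + 1) ^ α :=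
          sub_nonneg.2 (Real.rpow_le_rpow (hL _).le (by linarith [hLs n]) hα0.le)
        have hc' : (L n ^ α - L (n + 1) ^ α) / (l n ^ (1 - 1 / p) * L n ^ α) ≤
            α * (l n ^ (1 / p) / L n) := by
          rw [mul_comm (l n ^ _), ← div_div, div_le_iff₀ hw]
          refine hc.trans_eq ?_
          have : l n ^ (1 / p) * l n ^ (1 - 1 / p) = l n := by
            rw [← Real.rpow_add hln, add_sub_cancel, Real.rpow_one]
          nth_rewrite 1 [← this]
          ring
        calc _ ≤ (α * (l n ^ (1 / p) / L n) * S n) ^ p := by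
              refine Real.rpow_le_rpow ?_ (mul_le_mul_of_nonneg_right hc' (hS n)) hp0.le
              exact mul_nonneg (div_nonneg hcnn (by positivity)) (hS n)
          _ = (α * (l n ^ (1 / p) * (S n / L n))) ^ p := by congr 1; ring
          _ = α ^ p * (l n * (S n / L n) ^ p) := by
              have hq := div_nonneg (hS n) hLn.le
              rw [Real.mul_rpow hα0.le (by positivity), Real.mul_rpow (by positivity) hq, ← hlp]
    _ ≤ α ^ p * ((p / (p - 1)) ^ p * ∑ n ∈ Finset.range K, y n ^ p) := by
        rw [← Finset.mul_sum]
        gcongr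
    _ = _ := by
        rw [mul_div_assoc, Real.mul_rpow hα0.le hpq.symm.nonneg, mul_assoc]

/-- Inequality (3.5): for `p > 1`, `α ≥ 1`, a positive summable sequence `lam`
(indexed from `0`) and a nonnegative sequence `y`, with `Λ*ₙ = ∑_{k≥n} lam k`
the tail sum,
`∑ₙ ( (((Λ*ₙ)^α - (Λ*_{n+1})^α)/(λₙ^{1-1/p} (Λ*ₙ)^α)) ∑_{k≥n} λₖ^{1-1/p} yₖ )^p
  ≤ (αp/(p-1))^p ∑ₙ yₙ^p`,
the sums being taken in `[0,∞]`. -/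
theorem ineq_three_five (p α : ℝ) (hp : 1 < p) (hα : 1 ≤ α)
    (lam y : ℕ → ℝ) (hlam : ∀ n, 0 < lam n) (hsum : Summable lam)
    (hy : ∀ n, 0 ≤ y n) :
    ∑' n : ℕ,
        (ENNReal.ofReal
            (((∑' j : ℕ, lam (n + j)) ^ α - (∑' j : ℕ, lam (n + 1 + j)) ^ α) /
              (lam n ^ (1 - 1 / p) * (∑' j : ℕ, lam (n + j)) ^ α)) *
          ∑' k : ℕ, ENNReal.ofReal (lam (n + k) ^ (1 - 1 / p) * y (n + k))) ^ p
      ≤ ENNReal.ofReal ((α * p / (p - 1)) ^ p) *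
          ∑' n : ℕ, ENNReal.ofReal (y n ^ p) := by
  have hp0 : 0 < p := by linarith
  have hshift (n : ℕ) : Summable fun j ↦ lam (n + j) :=
    hsum.comp_injective (add_right_injective n)
  set L : ℕ → ℝ := fun n ↦ ∑' j, lam (n + j) with hLdef
  have hL (n : ℕ) : 0 < L n := (hshift n).tsum_pos (fun j ↦ (hlam _).le) 0 (hlam _)
  have hLs (n : ℕ) : L n = lam n + L (n + 1) := by
    simp only [hLdef]
    rw [(hshift n).tsum_eq_zero_add]
    simp only [add_zero, add_assoc, add_comm 1]
  have hterm (k : ℕ) : 0 ≤ lam k ^ (1 - 1 / p) * y k :=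
    mul_nonneg (Real.rpow_nonneg (hlam k).le _) (hy k)
  set c : ℕ → ℝ := fun n ↦
    (L n ^ α - L (n + 1) ^ α) / (lam n ^ (1 - 1 / p) * L n ^ α) with hcdef
  have hc (n : ℕ) : 0 ≤ c n :=
    div_nonneg (sub_nonneg.2 (Real.rpow_le_rpow (hL _).le (by linarith [hLs n, hlam n])
      (by linarith)))
      (mul_nonneg (Real.rpow_nonneg (hlam n).le _) (Real.rpow_nonneg (hL n).le _))
  have hS (n K : ℕ) : 0 ≤ ∑ k ∈ Finset.Ico n K, lam k ^ (1 - 1 / p) * y k :=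
    Finset.sum_nonneg fun k _ ↦ hterm k
  refine ENNReal.tsum_le_of_sum_range_le fun N ↦ ?_
  have hlim : Filter.Tendsto (fun M ↦ ∑ n ∈ Finset.range N, (ENNReal.ofReal (c n) *
        ∑ k ∈ Finset.range M, ENNReal.ofReal (lam (n + k) ^ (1 - 1 / p) * y (n + k))) ^ p)
      Filter.atTop (nhds (∑ n ∈ Finset.range N, (ENNReal.ofReal (c n) *
        ∑' k, ENNReal.ofReal (lam (n + k) ^ (1 - 1 / p) * y (n + k))) ^ p)) :=
    tendsto_finsetSum _ fun n _ ↦ (ENNReal.continuous_rpow_const.tendsto _).comp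
      (ENNReal.Tendsto.const_mul (ENNReal.tendsto_nat_tsum _) (Or.inr ENNReal.ofReal_ne_top))
  refine le_of_tendsto' hlim fun M ↦ ?_
  calc _ ≤ ∑ n ∈ Finset.range N, ENNReal.ofReal
          ((c n * ∑ k ∈ Finset.Ico n (N + M), lam k ^ (1 - 1 / p) * y k) ^ p) := by
        refine Finset.sum_le_sum fun n hn ↦ ?_
        have hnN := Finset.mem_range.1 hn
        rw [← ENNReal.ofReal_rpow_of_nonneg (mul_nonneg (hc n) (hS n _)) hp0.le,
          ENNReal.ofReal_mul (hc n), ← ENNReal.ofReal_sum_of_nonneg fun k _ ↦ hterm (n + k)]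
        gcongr
        rw [Finset.sum_Ico_eq_sum_range]
        exact Finset.sum_le_sum_of_subset_of_nonneg
          (Finset.range_subset_range.2 (by lia)) fun k _ _ ↦ hterm (n + k)
    _ ≤ ∑ n ∈ Finset.range (N + M), ENNReal.ofReal
          ((c n * ∑ k ∈ Finset.Ico n (N + M), lam k ^ (1 - 1 / p) * y k) ^ p) :=
        Finset.sum_le_sum_of_subset (Finset.range_subset_range.2 (by lia))
    _ ≤ ENNReal.ofReal ((α * p / (p - 1)) ^ p * ∑ n ∈ Finset.range (N + M), y n ^ p) := by
        rw [← ENNReal.ofReal_sum_of_nonneg fun n _ ↦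
          Real.rpow_nonneg (mul_nonneg (hc n) (hS n _)) _]
        exact ENNReal.ofReal_le_ofReal (hardy_rpow_sum_range hp hα hlam hL hy hLs _)
    _ ≤ _ := by
        have : 0 ≤ α * p / (p - 1) :=
          div_nonneg (mul_nonneg (by linarith) hp0.le) (by linarith)
        rw [ENNReal.ofReal_mul (Real.rpow_nonneg this _),
          ENNReal.ofReal_sum_of_nonneg fun n _ ↦ Real.rpow_nonneg (hy n) _]
        gcongr
        exact ENNReal.sum_le_tsum _
end
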